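/- Assume n > 0, m > 0, δ(u,v₁) > 0, δ(u,v₂) > 0, δ(v₁,v₂) ≥ 0, and (m²+n·m)·(δ(u,v₁)+δ(u,v₂)) − n·δ(v₁,v₂) ≥ 0. Then |δ(u,v₂)·det A₁| + |δ(u,v₁)·det A₂| = |det B₃| + |det B₄|; that is, the total ev×j-multiplicity of the curve types on the two sides of the wall is balanced (types α₁, α₂ on one side, α₃, α₄ on the other). -/

import Mathlib

/-- δ(x,y) = x₁y₂ − x₂y₁ for x, y ∈ ℝ². -/
def del (x y : ℝ × ℝ) : ℝ := x.1 * y.2 - x.2 * y.1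

/-- The 7×7 matrix A₁ (type α₁, flat cycle surviving on the e₂-side). -/
def A₁ (u v₁ v₂ : ℝ × ℝ) (n m : ℝ) : Matrix (Fin 7) (Fin 7) ℝ :=
  !![1, 0, 0,    0,    n*u.1, 0,       (n+m)*u.1;
     0, 1, 0,    0,    n*u.2, 0,       (n+m)*u.2;
     1, 0, v₁.1, 0,    0,     0,       0;
     0, 1, v₁.2, 0,    0,     0,       0;
     1, 0, 0,    v₂.1, 0,     n*m*u.1, (n+m)*u.1;
     0, 1, 0,    v₂.2, 0,     n*m*u.2, (n+m)*u.2;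
     0, 0, 0,    0,    0,     m+n,     0]

/-- The 7×7 matrix A₂ (type α₂, flat cycle surviving on the e₁-side): equal to A₁
except that the last entries of the first two rows are 0. -/
def A₂ (u v₁ v₂ : ℝ × ℝ) (n m : ℝ) : Matrix (Fin 7) (Fin 7) ℝ :=
  !![1, 0, 0,    0,    n*u.1, 0,       0;
     0, 1, 0,    0,    n*u.2, 0,       0;
     1, 0, v₁.1, 0,    0,     0,       0;
     0, 1, v₁.2, 0,    0,     0,       0;
     1, 0, 0,    v₂.1, 0,     n*m*u.1, (n+m)*u.1;
     0, 1, 0,    v₂.2, 0,     n*m*u.2, (n+m)*u.2;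
     0, 0, 0,    0,    0,     m+n,     0]

/-- The 9×9 matrix B₃ (non-degenerate type α₃). -/
def B₃ (u v₁ v₂ : ℝ × ℝ) (n m : ℝ) : Matrix (Fin 9) (Fin 9) ℝ :=
  !![1, 0, 0,    0,    n*u.1, 0,     0,        0,           0;
     0, 1, 0,    0,    n*u.2, 0,     0,        0,           0;
     1, 0, v₁.1, 0,    0,     0,     0,        0,           0;
     0, 1, v₁.2, 0,    0,     0,     0,        0,           0;
     1, 0, 0,    v₂.1, n*u.1, n*u.1, 0,        0,           0;
     0, 1, 0,    v₂.2, n*u.2, n*u.2, 0,        0,           0;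
     0, 0, 0,    0,    n*u.1, n*u.1, -(m*u.1), v₁.1+n*u.1,  -v₂.1+n*u.1;
     0, 0, 0,    0,    n*u.2, n*u.2, -(m*u.2), v₁.2+n*u.2,  -v₂.2+n*u.2;
     0, 0, 0,    0,    1,     1,     1,        1,           1]

/-- The 9×9 matrix B₄ (non-degenerate type α₄). -/
def B₄ (u v₁ v₂ : ℝ × ℝ) (n m : ℝ) : Matrix (Fin 9) (Fin 9) ℝ :=
  !![1, 0, 0,    0,    n*u.1, 0,     0,        -v₁.1-m*u.1, 0;
     0, 1, 0,    0,    n*u.2, 0,     0,        -v₁.2-m*u.2, 0;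
     1, 0, v₁.1, 0,    0,     0,     0,        0,           0;
     0, 1, v₁.2, 0,    0,     0,     0,        0,           0;
     1, 0, 0,    v₂.1, n*u.1, n*u.1, 0,        -v₁.1-m*u.1, v₂.1-m*u.1;
     0, 1, 0,    v₂.2, n*u.2, n*u.2, 0,        -v₁.2-m*u.2, v₂.2-m*u.2;
     0, 0, 0,    0,    n*u.1, n*u.1, -(m*u.1), -v₁.1-m*u.1, v₂.1-m*u.1;
     0, 0, 0,    0,    n*u.2, n*u.2, -(m*u.2), -v₁.2-m*u.2, v₂.2-m*u.2;
     0, 0, 0,    0,    1,     1,     1,        1,           1]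

theorem det_A₁ (u v₁ v₂ : ℝ × ℝ) (n m : ℝ) :
    (A₁ u v₁ v₂ n m).det =
      -(n * (n + m) ^ 2 * (del u v₁ * del u v₂)) := by
  simp only [A₁, del]
  eval_det
  ring

theorem det_A₂ (u v₁ v₂ : ℝ × ℝ) (n m : ℝ) :
    (A₂ u v₁ v₂ n m).det =
      -(n * (n + m) ^ 2 * (del u v₁ * del u v₂)) := by
  simp only [A₂, del]
  eval_det
  ring

theorem det_B₃ (u v₁ v₂ : ℝ × ℝ) (n m : ℝ) :
    (B₃ u v₁ v₂ n m).det =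
      -(n ^ 2 * (del u v₁ * del u v₂) * (del v₁ v₂ + (n + m) * (del u v₁ + del u v₂))) := by
  simp only [B₃, del]
  eval_det
  ring

theorem det_B₄ (u v₁ v₂ : ℝ × ℝ) (n m : ℝ) :
    (B₄ u v₁ v₂ n m).det =
      n * (del u v₁ * del u v₂) * ((m ^ 2 + n * m) * (del u v₁ + del u v₂) - n * del v₁ v₂) := by
  simp only [B₄, del]
  eval_det
  ring

/-- If (m²+nm)(δ(u,v₁)+δ(u,v₂)) − n·δ(v₁,v₂) ≥ 0, then the total ev×j-multiplicity on
the two sides of the wall is balanced: types α₁, α₂ on one side, α₃, α₄ on the other. -/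
theorem wall_balance_case1 (u v₁ v₂ : ℝ × ℝ) (n m : ℝ)
    (hn : 0 < n) (hm : 0 < m)
    (h₁ : 0 < del u v₁) (h₂ : 0 < del u v₂) (h₁₂ : 0 ≤ del v₁ v₂)
    (hcase : 0 ≤ (m^2 + n*m) * (del u v₁ + del u v₂) - n * del v₁ v₂) :
    |del u v₂ * (A₁ u v₁ v₂ n m).det| + |del u v₁ * (A₂ u v₁ v₂ n m).det|
      = |(B₃ u v₁ v₂ n m).det| + |(B₄ u v₁ v₂ n m).det| := by
  rw [det_A₁, det_A₂, det_B₃, det_B₄, mul_neg, mul_neg, abs_neg, abs_neg, abs_neg,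
    abs_of_pos (by positivity), abs_of_pos (by positivity), abs_of_pos (by positivity),
    abs_of_nonneg (mul_nonneg (by positivity) hcase)]
  ring
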